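/- Let ε > 0 and let H be a 3-graph on n vertices with at least one edge and δ₂⁺(H) ≥ (1/3 + ε)·n. Then H contains at least (ε/162)·n⁴ copies of K₄⁻; that is, the number of 3-element sets of edges of H whose union has exactly four vertices is at least (ε/162)·n⁴. -/

import Mathlib

open Finset

/-- The co-degree of a vertex set `S` in the hypergraph with edge set `E`:
the number of edges containing `S`. -/
def coDeg {n : ℕ} (E : Finset (Finset (Fin n))) (S : Finset (Fin n)) : ℕ :=
  (E.filter (fun e => S ⊆ e)).card

/-- The minimum positive co-degree `δ⁺_{r-1}` of an `r`-graph on `Fin n` with edge set `E`: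
the largest `k` such that every `(r-1)`-set of vertices contained in at least one edge is
contained in at least `k` edges (i.e. the minimum of the positive co-degrees). -/
noncomputable def minPosCoDeg (r n : ℕ) (E : Finset (Finset (Fin n))) : ℕ :=
  sInf {d : ℕ | ∃ S : Finset (Fin n), S.card = r - 1 ∧ coDeg E S = d ∧ 0 < d}

/-- `E` contains a copy of `F`: an injection of the vertices of `F` mapping
edges of `F` to edges of `E`. -/
def Contains {α β : Type*} [DecidableEq α] [DecidableEq β]
    (F : Finset (Finset α)) (E : Finset (Finset β)) : Prop :=
  ∃ f : α → β, Function.Injective f ∧ ∀ e ∈ F, e.image f ∈ E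

/-- The positive co-degree Turán number `co⁺ex_r(n, F)`: the maximum of the minimum positive
co-degree over all `F`-free `r`-graphs on `n` vertices with at least one edge. -/
noncomputable def coPlusEx {α : Type*} [DecidableEq α] (r n : ℕ) (F : Finset (Finset α)) : ℕ :=
  sSup {d : ℕ | ∃ E : Finset (Finset (Fin n)),
    (∀ e ∈ E, e.card = r) ∧ E.Nonempty ∧ ¬ Contains F E ∧ minPosCoDeg r n E = d}


def K4minus : Finset (Finset (Fin 4)) := {{0,1,2}, {0,1,3}, {0,2,3}}

def K4 : Finset (Finset (Fin 4)) := {{0,1,2}, {0,1,3}, {0,2,3}, {1,2,3}}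

def F5 : Finset (Finset (Fin 5)) := {{0,1,2}, {0,1,3}, {2,3,4}}

def F32 : Finset (Finset (Fin 5)) := {{0,1,2}, {0,3,4}, {1,3,4}, {2,3,4}}

def Fano : Finset (Finset (Fin 7)) :=
  {{0,1,2}, {2,3,4}, {0,4,5}, {1,3,5}, {0,3,6}, {1,4,6}, {2,5,6}}

def F33 : Finset (Finset (Fin 6)) :=
  {{0,1,2}, {0,3,4}, {0,3,5}, {0,4,5}, {1,3,4}, {1,3,5}, {1,4,5}, {2,3,4}, {2,3,5}, {2,4,5}}

def C5 : Finset (Finset (Fin 5)) := {{0,1,2}, {1,2,3}, {2,3,4}, {0,3,4}, {0,1,4}}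

def C5minus : Finset (Finset (Fin 5)) := {{0,1,2}, {1,2,3}, {2,3,4}, {0,3,4}}

def K222 : Finset (Finset (Fin 6)) :=
  {{0,2,4}, {0,2,5}, {0,3,4}, {0,3,5}, {1,2,4}, {1,2,5}, {1,3,4}, {1,3,5}}

/-- `J k`: the 3-graph on `k+1` vertices whose edges are all triples containing the
distinguished vertex `0`. -/
def Jgraph (k : ℕ) : Finset (Finset (Fin (k+1))) :=
  (Finset.univ.powersetCard 3).filter (fun e => (0 : Fin (k+1)) ∈ e)

/-- `E` is (isomorphic to) the complete balanced `k`-partite 3-graph on `n` vertices: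
there is a partition of the vertices into `k` classes whose sizes differ by at most one,
such that the edges are exactly the triples of vertices in three pairwise distinct classes. -/
def IsCompleteBalancedMultipartite (n k : ℕ) (E : Finset (Finset (Fin n))) : Prop :=
  ∃ f : Fin n → Fin k,
    (∀ i j : Fin k, (Finset.univ.filter (fun v => f v = i)).card ≤
      (Finset.univ.filter (fun v => f v = j)).card + 1) ∧
    ∀ e : Finset (Fin n), e ∈ E ↔ (e.card = 3 ∧ (e.image f).card = 3)

/-- The unique (6,3,2)-design `H₆`. -/
def H6 : Finset (Finset (Fin 6)) :=
  {{0,1,2}, {0,1,3}, {2,3,4}, {2,3,5}, {0,4,5}, {1,4,5}, {0,2,4}, {0,3,5}, {1,2,5}, {1,3,4}}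

/-- `E` is (isomorphic to) a balanced blow-up of `H₆` on `n` vertices: the vertices are
partitioned into six classes of equal size, and the edges are exactly the triples whose
three vertices lie in classes forming an edge of `H₆`. -/
def IsBalancedH6Blowup (n : ℕ) (E : Finset (Finset (Fin n))) : Prop :=
  ∃ f : Fin n → Fin 6,
    (∀ i j : Fin 6, (Finset.univ.filter (fun v => f v = i)).card =
      (Finset.univ.filter (fun v => f v = j)).card) ∧
    ∀ e : Finset (Fin n), e ∈ E ↔ (e.card = 3 ∧ e.image f ∈ H6)

lemma aux_min {n : ℕ} (E : Finset (Finset (Fin n))) (p e : Finset (Fin n))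
    (hp : p.card = 2) (he : e ∈ E) (hpe : p ⊆ e) : minPosCoDeg 3 n E ≤ coDeg E p := by
  apply Nat.sInf_le
  refine ⟨p, hp, rfl, ?_⟩
  unfold coDeg
  exact Finset.card_pos.2 ⟨e, by simp [he, hpe]⟩

/-- the neighbourhood of a pair -/
def nbr {n : ℕ} (E : Finset (Finset (Fin n))) (p : Finset (Fin n)) : Finset (Fin n) :=
  Finset.univ.filter (fun v => v ∉ p ∧ insert v p ∈ E)

lemma aux_nbr {n : ℕ} (E : Finset (Finset (Fin n))) (hcard : ∀ e ∈ E, e.card = 3)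
    (p : Finset (Fin n)) (hp : p.card = 2) : coDeg E p ≤ (nbr E p).card := by
  unfold coDeg
  have : E.filter (fun e => p ⊆ e) ⊆ (nbr E p).image (fun v => insert v p) := by
    intro f hf
    rw [mem_filter] at hf
    obtain ⟨hf, hpf⟩ := hf
    have h1 : (f \ p).card = 1 := by
      rw [card_sdiff_of_subset hpf, hcard f hf, hp]
    obtain ⟨v, hv⟩ := card_eq_one.1 h1
    have hvm : v ∈ f \ p := by simp [hv]
    have hins : insert v p = f := by
      rw [← sdiff_union_of_subset hpf, hv]; rfl
    rw [mem_image]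
    refine ⟨v, ?_, hins⟩
    simp only [nbr, mem_filter, mem_univ, true_and]
    exact ⟨(mem_sdiff.1 hvm).2, hins ▸ hf⟩
  exact (card_le_card this).trans card_image_le

lemma aux_edges {n : ℕ} (E : Finset (Finset (Fin n))) (hcard : ∀ e ∈ E, e.card = 3)
    (hne : E.Nonempty) : (minPosCoDeg 3 n E) ^ 3 ≤ 6 * E.card := by
  set d := minPosCoDeg 3 n E with hd
  set D : Finset (Finset (Fin n)) :=
    (univ.powersetCard 2).filter (fun p => ∃ e ∈ E, p ⊆ e) with hD
  have hDm : ∀ p, p ∈ D ↔ p.card = 2 ∧ ∃ e ∈ E, p ⊆ e := by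
    intro p; simp [hD, mem_powersetCard]
  have hDd : ∀ p ∈ D, d ≤ coDeg E p := by
    intro p hp
    obtain ⟨h2, e, he, hpe⟩ := (hDm p).1 hp
    exact aux_min E p e h2 he hpe
  have hDn : ∀ p ∈ D, d ≤ (nbr E p).card := fun p hp =>
    (hDd p hp).trans (aux_nbr E hcard p ((hDm p).1 hp).1)
  have h1 : D.card * d ≤ E.card * 3 := by
    apply card_mul_le_card_mul (fun p e => p ⊆ e)
    · intro p hp
      exact hDd p hp
    · intro e he
      have : D.bipartiteBelow (fun p e => p ⊆ e) e ⊆ e.powersetCard 2 := by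
        intro p hp
        rw [mem_bipartiteBelow] at hp
        exact mem_powersetCard.2 ⟨hp.2, ((hDm p).1 hp.1).1⟩
      calc _ ≤ _ := card_le_card this
        _ = 3 := by rw [card_powersetCard, hcard e he]; rfl
  set V : Finset (Fin n) := univ.filter (fun v => ∃ e ∈ E, v ∈ e) with hV
  have h2 : V.card * d ≤ D.card * 2 := by
    apply card_mul_le_card_mul (fun v p => v ∈ p)
    · intro v hv
      simp only [hV, mem_filter, mem_univ, true_and] at hv
      obtain ⟨e, he, hve⟩ := hv
      obtain ⟨b, hbe, hbv⟩ := exists_mem_ne (by rw [hcard e he]; norm_num : 1 < e.card) v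
      have hpD : ({v, b} : Finset (Fin n)) ∈ D := by
        rw [hDm]
        refine ⟨card_pair hbv.symm, e, he, ?_⟩
        intro x hx
        simp only [mem_insert, mem_singleton] at hx
        rcases hx with rfl | rfl <;> assumption
      refine (hDn _ hpD).trans ?_
      apply card_le_card_of_injOn (fun c => ({v, c} : Finset (Fin n)))
      · intro c hc
        simp only [nbr, coe_filter, Set.mem_ofPred_eq, mem_univ, true_and, mem_insert,
          mem_singleton, not_or] at hc
        simp only [coe_bipartiteAbove, Set.mem_ofPred_eq, hDm]
        refine ⟨⟨card_pair (Ne.symm hc.1.1), _, hc.2, ?_⟩, by simp⟩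
        intro x hx
        simp only [mem_insert, mem_singleton] at hx ⊢
        tauto
      · intro c hc c' hc' h
        simp only [nbr, coe_filter, Set.mem_ofPred_eq, mem_univ, true_and, mem_insert,
          mem_singleton, not_or] at hc hc'
        have : c ∈ ({v, c'} : Finset (Fin n)) := by
          have h' : ({v, c} : Finset (Fin n)) = {v, c'} := h
          rw [← h']; simp
        simp only [mem_insert, mem_singleton] at this
        tauto
    · intro p hp
      have : V.bipartiteBelow (fun v p => v ∈ p) p ⊆ p := by
        intro v hv
        exact ((mem_bipartiteBelow _).1 hv).2
      exact (card_le_card this).trans ((hDm p).1 hp).1.le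
  have h3 : d ≤ V.card := by
    obtain ⟨e, he⟩ := hne
    obtain ⟨p, hpe, hp⟩ := exists_subset_card_eq (by rw [hcard e he]; norm_num : 2 ≤ e.card)
    refine (hDn p ((hDm p).2 ⟨hp, e, he, hpe⟩)).trans (card_le_card ?_)
    intro v hv
    simp only [nbr, mem_filter, mem_univ, true_and] at hv
    simp only [hV, mem_filter, mem_univ, true_and]
    exact ⟨_, hv.2, by simp⟩
  calc d ^ 3 = (d * d) * d := by ring
    _ ≤ (V.card * d) * d := by gcongr
    _ ≤ (D.card * 2) * d := by gcongr
    _ = 2 * (D.card * d) := by ring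
    _ ≤ 2 * (E.card * 3) := by gcongr
    _ = _ := by ring

lemma aux_choose (k : ℕ) : k ≤ k.choose 2 + 1 := by
  induction k with
  | zero => simp
  | succ k ih =>
    rcases k with _ | k
    · simp
    · rw [Nat.choose_succ_succ' (k+1) 1, Nat.choose_one_right]; omega

lemma aux_local {n : ℕ} (E : Finset (Finset (Fin n))) (hcard : ∀ e ∈ E, e.card = 3)
    (e : Finset (Fin n)) (he : e ∈ E) :
    3 * minPosCoDeg 3 n E ≤
      (((E.powersetCard 3).filter (fun S => (S.sup id).card = 4)).filter
        (fun S => e ∈ S)).card + n := by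
  set d := minPosCoDeg 3 n E with hd
  set F : Fin n → Finset (Finset (Fin n)) :=
    fun v => E.filter (fun f => f ⊆ insert v e ∧ v ∈ f) with hF
  -- lower bound on the total size of the families
  have hsum : 3 * d ≤ ∑ v ∈ eᶜ, (F v).card + 3 := by
    have hdis : Set.PairwiseDisjoint (↑(e.powersetCard 2) : Set (Finset (Fin n)))
        (fun p => (E.filter (fun f => p ⊆ f)).erase e) := by
      intro p hp q hq hpq
      simp only [mem_coe, mem_powersetCard] at hp hq
      rw [Function.onFun, disjoint_left]
      intro f hf hf'
      simp only [mem_erase, mem_filter] at hf hf'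
      apply hf.1
      have hu : p ∪ q ⊆ f ∩ e :=
        subset_inter (union_subset hf.2.2 hf'.2.2) (union_subset hp.1 hq.1)
      have h3 : 2 < (p ∪ q).card := by
        by_contra hlt
        have e1 : p = p ∪ q := eq_of_subset_of_card_le subset_union_left (by omega)
        have e2 : q = p ∪ q := eq_of_subset_of_card_le subset_union_right (by omega)
        exact hpq (e1.trans e2.symm)
      have h4 := card_le_card hu
      have hfe := hcard f hf.2.1
      have hee := hcard e he
      have e1 : f ∩ e = f := eq_of_subset_of_card_le inter_subset_left (by omega)
      have e2 : f ∩ e = e := eq_of_subset_of_card_le inter_subset_right (by omega)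
      exact e1.symm.trans e2
    have hsub : (e.powersetCard 2).biUnion (fun p => (E.filter (fun f => p ⊆ f)).erase e)
        ⊆ (eᶜ).biUnion F := by
      intro f hf
      simp only [mem_biUnion, mem_powersetCard, mem_erase, mem_filter] at hf
      obtain ⟨p, ⟨hpe, hp⟩, hfe, hfE, hpf⟩ := hf
      have h1 : (f \ p).card = 1 := by
        rw [card_sdiff_of_subset hpf, hcard f hfE, hp]
      obtain ⟨v, hv⟩ := card_eq_one.1 h1
      have hvm : v ∈ f := by
        have : v ∈ f \ p := by simp [hv]
        exact (mem_sdiff.1 this).1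
      have hins : insert v p = f := by
        rw [← sdiff_union_of_subset hpf, hv]; rfl
      simp only [mem_biUnion, mem_compl, hF, mem_filter]
      refine ⟨v, ?_, hfE, ?_, hvm⟩
      · intro hve
        apply hfe
        apply eq_of_subset_of_card_le
        · rw [← hins]; exact insert_subset hve hpe
        · rw [hcard e he, hcard f hfE]
      · rw [← hins]; exact insert_subset_insert _ hpe
    have hle := (card_le_card hsub).trans card_biUnion_le
    rw [card_biUnion hdis] at hle
    have hlow : ∑ p ∈ e.powersetCard 2, d ≤
        ∑ p ∈ e.powersetCard 2, (((E.filter (fun f => p ⊆ f)).erase e).card + 1) := by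
      apply sum_le_sum
      intro p hp
      rw [mem_powersetCard] at hp
      rw [card_erase_add_one (by simp [he, hp.1])]
      exact aux_min E p e hp.2 he hp.1
    rw [sum_add_distrib, sum_const, sum_const, card_powersetCard, hcard e he] at hlow
    have : Nat.choose 3 2 = 3 := rfl
    rw [this] at hlow
    simp only [smul_eq_mul] at hlow
    omega
  have hec : (eᶜ).card + 3 = n := by
    have := card_compl_add_card e
    rwa [hcard e he, Fintype.card_fin] at this
  -- the copies obtained
  have hFe : ∀ v ∈ eᶜ, e ∉ F v := by
    intro v hv h
    simp only [hF, mem_filter] at h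
    exact (mem_compl.1 hv) h.2.2
  set G : Fin n → Finset (Finset (Finset (Fin n))) :=
    fun v => ((F v).powersetCard 2).image (insert e) with hG
  have hGsup : ∀ v ∈ eᶜ, ∀ S ∈ G v, S.sup id = insert v e ∧ e ∈ S ∧ S ⊆ E ∧ S.card = 3 := by
    intro v hv S hS
    simp only [hG, mem_image, mem_powersetCard] at hS
    obtain ⟨T, ⟨hTF, hT⟩, rfl⟩ := hS
    refine ⟨?_, mem_insert_self _ _, ?_, ?_⟩
    · rw [sup_insert]
      apply subset_antisymm
      · apply union_subset (subset_insert _ _)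
        apply Finset.sup_le
        intro f hf
        exact (mem_filter.1 (hTF hf)).2.1
      · obtain ⟨f, hf⟩ := card_pos.1 (by omega : 0 < T.card)
        apply insert_subset
        · apply mem_union_right
          exact (le_sup (f := id) hf : f ≤ T.sup id) (mem_filter.1 (hTF hf)).2.2
        · exact subset_union_left
    · exact insert_subset he (hTF.trans (filter_subset _ _))
    · rw [card_insert_of_notMem (fun h => hFe v hv (hTF h)), hT]
  have hGdis : Set.PairwiseDisjoint (↑(eᶜ) : Set (Fin n)) G := by
    intro v hv w hw hvw
    rw [Function.onFun, disjoint_left]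
    intro S hS hS'
    have h1 := (hGsup v hv S hS).1
    have h2 := (hGsup w hw S hS').1
    have : v ∈ insert w e := by rw [← h2, h1]; simp
    rcases mem_insert.1 this with h | h
    · exact hvw h
    · exact (mem_compl.1 hv) h
  have hGsub : (eᶜ).biUnion G ⊆ ((E.powersetCard 3).filter
      (fun S => (S.sup id).card = 4)).filter (fun S => e ∈ S) := by
    intro S hS
    obtain ⟨v, hv, hS⟩ := mem_biUnion.1 hS
    obtain ⟨h1, h2, h3, h4⟩ := hGsup v hv S hS
    simp only [mem_filter, mem_powersetCard]
    refine ⟨⟨⟨h3, h4⟩, ?_⟩, h2⟩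
    rw [h1, card_insert_of_notMem (mem_compl.1 hv), hcard e he]
  have hGcard : ∀ v ∈ eᶜ, (F v).card ≤ (G v).card + 1 := by
    intro v hv
    have : (G v).card = (F v).card.choose 2 := by
      rw [hG, card_image_of_injOn, card_powersetCard]
      intro T hT T' hT' h
      have a1 : e ∉ T := fun h => hFe v hv ((mem_powersetCard.1 hT).1 h)
      have a2 : e ∉ T' := fun h => hFe v hv ((mem_powersetCard.1 hT').1 h)
      rw [← erase_insert a1, ← erase_insert a2]
      exact congrArg (fun X => X.erase e) h
    rw [this]
    exact aux_choose _
  have hX := card_le_card hGsub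
  rw [card_biUnion hGdis] at hX
  have hY := sum_le_sum hGcard
  rw [sum_add_distrib, sum_const, smul_eq_mul, mul_one] at hY
  omega

/-- Supersaturation for `K₄⁻`: a 3-graph on `n` vertices with minimum positive co-degree
at least `(1/3 + ε)·n` contains at least `(ε/162)·n⁴` copies of `K₄⁻`, i.e. 3-element sets
of edges whose union has exactly four vertices. -/
theorem K4minus_supersaturation (ε : ℝ) (hε : 0 < ε) (n : ℕ)
    (E : Finset (Finset (Fin n))) (hcard : ∀ e ∈ E, e.card = 3) (hne : E.Nonempty)
    (hdeg : (1 / 3 + ε) * n ≤ (minPosCoDeg 3 n E : ℝ)) :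
    ε / 162 * (n : ℝ) ^ 4 ≤
      (((E.powersetCard 3).filter (fun S => (S.sup id).card = 4)).card : ℝ) := by
  set P := (E.powersetCard 3).filter (fun S => (S.sup id).card = 4) with hP
  set d := minPosCoDeg 3 n E with hd
  have h1 := aux_edges E hcard hne
  have h2 : ∑ e ∈ E, (P.filter (fun S => e ∈ S)).card = P.card * 3 := by
    have := sum_card_bipartiteAbove_eq_sum_card_bipartiteBelow (s := E) (t := P)
      (fun e S => e ∈ S)
    unfold bipartiteAbove bipartiteBelow at this
    rw [this]
    apply sum_const_nat
    intro S hS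
    rw [hP, mem_filter, mem_powersetCard] at hS
    rw [filter_mem_eq_inter, inter_eq_right.2 hS.1.1, hS.1.2]
  have h3 : E.card * (3 * d) ≤ P.card * 3 + E.card * n := by
    have := sum_le_sum (aux_local E hcard)
    rw [sum_add_distrib, sum_const, sum_const, smul_eq_mul, smul_eq_mul] at this
    rw [← h2]
    exact this
  rw [← hd] at h1
  have h1' : (d : ℝ) ^ 3 ≤ 6 * E.card := by exact_mod_cast h1
  have h3' : (E.card : ℝ) * (3 * d) ≤ P.card * 3 + E.card * n := by exact_mod_cast h3
  have hn : (0 : ℝ) ≤ n := Nat.cast_nonneg n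
  have h4 : (n : ℝ) / 3 ≤ d := by nlinarith [mul_nonneg hε.le hn]
  have h5 : ((n : ℝ) / 3) ^ 3 ≤ (d : ℝ) ^ 3 := by gcongr
  have h6 : (n : ℝ) ^ 3 / 162 ≤ E.card := by nlinarith
  have h7 : (E.card : ℝ) * (3 * ((1 / 3 + ε) * n)) ≤ E.card * (3 * d) := by gcongr
  have h8 : (n : ℝ) ^ 3 / 162 * (ε * n) ≤ E.card * (ε * n) := by gcongr
  nlinarith
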